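/- arXiv:2405.13302 — 3 statements merged into one kernel-verified Lean document; each statement's English description precedes it below -/
import Mathlib

section
/- Let (X, d) be a metric space in which the distance between any two distinct points is a positive integer, and let x, y ∈ X satisfy d(x, y) = 1. Let μ_x and μ_y be finitely supported probability measures on X with μ_x supported on {x} ∪ {z : d(z, x) = 1} and μ_y supported on {y} ∪ {z : d(z, y) = 1}, and suppose α := μ_x(x) satisfies μ_x(x) ≤ μ_y(y) and α < 1. Define ν_x = (μ_x − α δ_x)/(1 − α) and ν_y = (μ_y − α δ_y)/(1 − α). Then W₁(μ_x, μ_y) ≤ α + (1 − α) · [1 + (1 − ν_x(y) − ν_y(x) − Σ_{z : d(z,x)=1, d(z,y)=1} max(ν_x(z), ν_y(z)))₊ + (1 − ν_x(y) − ν_y(x) − Σ_{z : d(z,x)=1, d(z,y)=1} min(ν_x(z), ν_y(z)))₊ − Σ_{z : d(z,x)=1, d(z,y)=1} min(ν_x(z), ν_y(z))]. -/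
open scoped Classical

/-- Wasserstein distance between finitely supported mass functions `μ ν : X → ℝ`,
defined as the infimum of total transport cost over all finitely supported couplings. -/
noncomputable def W1 {X : Type*} (d : X → X → ℝ) (μ ν : X → ℝ) : ℝ :=
  sInf { c : ℝ | ∃ γ : (X × X) →₀ ℝ,
    (∀ p, 0 ≤ γ p) ∧
    (∀ u : X, (∑ᶠ v : X, γ (u, v)) = μ u) ∧
    (∀ v : X, (∑ᶠ u : X, γ (u, v)) = ν v) ∧
    c = ∑ᶠ p : X × X, d p.1 p.2 * γ p }

/-- `μ : X → ℝ` is a finitely supported probability mass function. -/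
def IsFinProb {X : Type*} (μ : X → ℝ) : Prop :=
  (∀ z, 0 ≤ μ z) ∧ (Function.support μ).Finite ∧ (∑ᶠ z, μ z) = 1

/-- A transport plan from `μ` to `ν`, carried by the finite set `S`, of total cost at most `c`. -/
def HasPlan {X : Type*} (S : Finset X) (d : X → X → ℝ) (μ ν : X → ℝ) (c : ℝ) : Prop :=
  ∃ γ : X → X → ℝ, (∀ u v, 0 ≤ γ u v) ∧ (∀ u v, γ u v ≠ 0 → u ∈ S ∧ v ∈ S) ∧
    (∀ u, ∑ v ∈ S, γ u v = μ u) ∧ (∀ v, ∑ u ∈ S, γ u v = ν v) ∧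
    ∑ u ∈ S, ∑ v ∈ S, d u v * γ u v ≤ c

namespace HasPlan

variable {X : Type*} {S : Finset X} {d : X → X → ℝ} {μ ν μ' ν' : X → ℝ} {c c' : ℝ}

theorem add (h : HasPlan S d μ ν c) (h' : HasPlan S d μ' ν' c') :
    HasPlan S d (μ + μ') (ν + ν') (c + c') := by
  obtain ⟨γ, h0, hS, hr, hc, hcost⟩ := h
  obtain ⟨γ', h0', hS', hr', hc', hcost'⟩ := h'
  refine ⟨γ + γ', fun u v => add_nonneg (h0 u v) (h0' u v), fun u v huv => ?_, fun u => ?_,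
    fun v => ?_, ?_⟩
  · by_cases hz : γ u v = 0
    · exact hS' u v (by simpa [hz] using huv)
    · exact hS u v hz
  · simp [Finset.sum_add_distrib, hr, hr']
  · simp [Finset.sum_add_distrib, hc, hc']
  · simp only [Pi.add_apply, mul_add, Finset.sum_add_distrib]
    exact add_le_add hcost hcost'

theorem smul (h : HasPlan S d μ ν c) {t : ℝ} (ht : 0 ≤ t) :
    HasPlan S d (t • μ) (t • ν) (t * c) := by
  obtain ⟨γ, h0, hS, hr, hc, hcost⟩ := h
  refine ⟨fun u v => t * γ u v, fun u v => mul_nonneg ht (h0 u v),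
    fun u v huv => hS u v (right_ne_zero_of_mul huv), fun u => ?_, fun v => ?_, ?_⟩
  · simp [← Finset.mul_sum, hr]
  · simp [← Finset.mul_sum, hc]
  · simp only [mul_left_comm _ t, ← Finset.mul_sum]
    exact mul_le_mul_of_nonneg_left hcost ht

theorem single {x y : X} (hx : x ∈ S) (hy : y ∈ S) :
    HasPlan S d (Pi.single x 1) (Pi.single y 1) (d x y) := by
  refine ⟨fun u v => Pi.single (M := fun _ => ℝ) x 1 u * Pi.single (M := fun _ => ℝ) y 1 v,
    fun u v => ?_, fun u v huv => ?_, fun u => ?_, fun v => ?_, ?_⟩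
  · exact mul_nonneg (by simp only [Pi.single_apply]; split_ifs <;> simp)
      (by simp only [Pi.single_apply]; split_ifs <;> simp)
  · simp only [Pi.single_apply, ne_eq, mul_eq_zero, not_or, ite_eq_right_iff, not_forall] at huv
    obtain ⟨⟨rfl, -⟩, rfl, -⟩ := huv
    exact ⟨hx, hy⟩
  · simp [Pi.single_apply, hy]
  · simp [Pi.single_apply, hx]
  · simp [Pi.single_apply, hx, hy]

theorem refl (hd : ∀ u, d u u = 0) (h0 : ∀ u, 0 ≤ μ u) (hS : ∀ u, μ u ≠ 0 → u ∈ S) :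
    HasPlan S d μ μ 0 := by
  have hz : ∀ u, u ∉ S → μ u = 0 := fun u hu => by_contra fun h => hu (hS u h)
  refine ⟨fun u v => if u = v then μ u else 0, fun u v => ?_, fun u v huv => ?_, fun u => ?_,
    fun v => ?_, ?_⟩
  · dsimp only
    split_ifs
    exacts [h0 u, le_rfl]
  · simp only [ne_eq, ite_eq_right_iff, not_forall] at huv
    obtain ⟨rfl, h⟩ := huv
    exact ⟨hS u h, hS u h⟩
  · simpa using fun h => (hz u h).symm
  · simpa using fun h => (hz v h).symm
  · simp [hd]

/-- Refining a transport plan `T` between the classes of two partitioned mass functions. -/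
theorem of_classes {ι κ : Type*} [Fintype ι] [Fintype κ] {s : ι → X → ℝ} {t : κ → X → ℝ}
    {T k : ι → κ → ℝ} (hs0 : ∀ i u, 0 ≤ s i u) (ht0 : ∀ j v, 0 ≤ t j v)
    (hsS : ∀ i u, s i u ≠ 0 → u ∈ S) (htS : ∀ j v, t j v ≠ 0 → v ∈ S)
    (hT0 : ∀ i j, 0 ≤ T i j) (hTr : ∀ i, ∑ j, T i j = ∑ u ∈ S, s i u)
    (hTc : ∀ j, ∑ i, T i j = ∑ v ∈ S, t j v)
    (hk : ∀ i j u v, s i u ≠ 0 → t j v ≠ 0 → d u v ≤ k i j) :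
    HasPlan S d (∑ i, s i) (∑ j, t j) (∑ i, ∑ j, k i j * T i j) := by
  set r : ι → ℝ := fun i => ∑ u ∈ S, s i u with hr
  set q : κ → ℝ := fun j => ∑ v ∈ S, t j v with hq
  have hr0 : ∀ i, 0 ≤ r i := fun i => Finset.sum_nonneg fun u _ => hs0 i u
  have hq0 : ∀ j, 0 ≤ q j := fun j => Finset.sum_nonneg fun v _ => ht0 j v
  have hsr : ∀ i u, r i = 0 → s i u = 0 := fun i u h => by_contra fun hne =>
    hne ((Finset.sum_eq_zero_iff_of_nonneg fun u _ => hs0 i u).1 h u (hsS i u hne))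
  have htq : ∀ j v, q j = 0 → t j v = 0 := fun j v h => by_contra fun hne =>
    hne ((Finset.sum_eq_zero_iff_of_nonneg fun v _ => ht0 j v).1 h v (htS j v hne))
  have hTr0 : ∀ i j, r i = 0 → T i j = 0 := fun i j h =>
    (Finset.sum_eq_zero_iff_of_nonneg fun j _ => hT0 i j).1 ((hTr i).trans h) j (Finset.mem_univ j)
  have hTq0 : ∀ i j, q j = 0 → T i j = 0 := fun i j h =>
    (Finset.sum_eq_zero_iff_of_nonneg fun i _ => hT0 i j).1 ((hTc j).trans h) i (Finset.mem_univ i)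
  have hrow : ∀ i j u, ∑ v ∈ S, T i j * (s i u / r i) * (t j v / q j) = T i j * (s i u / r i) := by
    intro i j u
    rw [← Finset.mul_sum, ← Finset.sum_div]
    by_cases h : q j = 0
    · simp [hTq0 i j h]
    · rw [div_self h, mul_one]
  have hcol : ∀ i j v, ∑ u ∈ S, T i j * (s i u / r i) * (t j v / q j) = T i j * (t j v / q j) := by
    intro i j v
    rw [← Finset.sum_mul, ← Finset.mul_sum, ← Finset.sum_div]
    by_cases h : r i = 0
    · simp [hTr0 i j h]
    · rw [div_self h, mul_one]
  have hnn : ∀ i j u v, 0 ≤ T i j * (s i u / r i) * (t j v / q j) := fun i j u v =>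
    mul_nonneg (mul_nonneg (hT0 i j) (div_nonneg (hs0 i u) (hr0 i)))
      (div_nonneg (ht0 j v) (hq0 j))
  refine ⟨fun u v => ∑ i, ∑ j, T i j * (s i u / r i) * (t j v / q j), fun u v =>
    Finset.sum_nonneg fun i _ => Finset.sum_nonneg fun j _ => hnn i j u v, fun u v huv => ?_,
    fun u => ?_, fun v => ?_, ?_⟩
  · obtain ⟨i, -, hi⟩ := Finset.exists_ne_zero_of_sum_ne_zero huv
    obtain ⟨j, -, hj⟩ := Finset.exists_ne_zero_of_sum_ne_zero hi
    refine ⟨hsS i u fun h => hj (by simp [h]), htS j v fun h => hj (by simp [h])⟩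
  · rw [Finset.sum_comm, Finset.sum_apply]
    refine Finset.sum_congr rfl fun i _ => ?_
    rw [Finset.sum_comm, Finset.sum_congr rfl fun j _ => hrow i j u, ← Finset.sum_mul, hTr i]
    exact mul_div_cancel_of_imp' (hsr i u)
  · rw [Finset.sum_comm, Finset.sum_congr rfl fun i _ => Finset.sum_comm, Finset.sum_comm,
      Finset.sum_apply]
    refine Finset.sum_congr rfl fun j _ => ?_
    rw [Finset.sum_congr rfl fun i _ => hcol i j v, ← Finset.sum_mul, hTc j]
    exact mul_div_cancel_of_imp' (htq j v)
  · have hle : ∀ u v, d u v * ∑ i, ∑ j, T i j * (s i u / r i) * (t j v / q j) ≤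
        ∑ i, ∑ j, k i j * (T i j * (s i u / r i) * (t j v / q j)) := by
      intro u v
      simp only [Finset.mul_sum]
      refine Finset.sum_le_sum fun i _ => Finset.sum_le_sum fun j _ => ?_
      by_cases hu : s i u = 0
      · simp [hu]
      by_cases hv : t j v = 0
      · simp [hv]
      exact mul_le_mul_of_nonneg_right (hk i j u v hu hv) (hnn i j u v)
    refine (Finset.sum_le_sum fun u _ => Finset.sum_le_sum fun v _ => hle u v).trans_eq ?_
    have hswap : ∀ u, ∑ v ∈ S, ∑ i, ∑ j, k i j * (T i j * (s i u / r i) * (t j v / q j)) =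
        ∑ i, ∑ j, k i j * (T i j * (s i u / r i)) := by
      intro u
      rw [Finset.sum_comm]
      refine Finset.sum_congr rfl fun i _ => ?_
      rw [Finset.sum_comm]
      refine Finset.sum_congr rfl fun j _ => ?_
      rw [← Finset.mul_sum, hrow]
    rw [Finset.sum_congr rfl fun u _ => hswap u, Finset.sum_comm]
    refine Finset.sum_congr rfl fun i _ => ?_
    rw [Finset.sum_comm]
    refine Finset.sum_congr rfl fun j _ => ?_
    rw [← Finset.mul_sum, ← Finset.mul_sum, ← Finset.sum_div]
    by_cases h : r i = 0
    · simp [hTr0 i j h]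
    · rw [div_self h, mul_one]

theorem W1_le (h : HasPlan S d μ ν c) (hd : ∀ u v, 0 ≤ d u v) : W1 d μ ν ≤ c := by
  obtain ⟨γ, h0, hS, hr, hc, hcost⟩ := h
  refine le_trans (csInf_le ⟨0, ?_⟩ ⟨Finsupp.onFinset (S ×ˢ S) (fun p => γ p.1 p.2)
    fun p hp => Finset.mem_product.2 (hS p.1 p.2 hp), fun p => h0 p.1 p.2, fun u => ?_,
    fun v => ?_, rfl⟩) (le_trans (le_of_eq ?_) hcost)
  · rintro _ ⟨γ', h0', -, -, rfl⟩
    exact finsum_nonneg fun p => mul_nonneg (hd _ _) (h0' p)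
  · rw [← hr u]
    exact finsum_eq_sum_of_support_subset _ fun v hv => (hS u v hv).2
  · rw [← hc v]
    exact finsum_eq_sum_of_support_subset _ fun u hu => (hS u v hu).1
  · rw [finsum_eq_sum_of_support_subset (s := S ×ˢ S), Finset.sum_product]
    · rfl
    · intro p hp
      exact Finset.mem_coe.2 (Finset.mem_product.2 (hS p.1 p.2 (right_ne_zero_of_mul hp)))

end HasPlan

/-- The antimonotone plan between two three-class mass functions, for the cost
`(i, j) ↦ 1 + min i j`. -/
theorem exists_antimonotone_plan {r q : Fin 3 → ℝ} (hr : ∀ i, 0 ≤ r i) (hq : ∀ j, 0 ≤ q j)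
    (htot : ∑ i, r i = ∑ j, q j) :
    ∃ T : Fin 3 → Fin 3 → ℝ, (∀ i j, 0 ≤ T i j) ∧ (∀ i, ∑ j, T i j = r i) ∧
      (∀ j, ∑ i, T i j = q j) ∧
      ∑ i, ∑ j, !![(1 : ℝ), 1, 1; 1, 2, 2; 1, 2, 3] i j * T i j =
        ∑ i, r i + max (∑ i, r i - r 0 - q 0) 0 + max (r 2 + q 2 - ∑ i, r i) 0 := by
  simp only [Fin.sum_univ_three, Fin.forall_fin_succ] at *
  simp only [Fin.succ_zero_eq_one, Fin.succ_one_eq_two, IsEmpty.forall_iff, and_true] at *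
  obtain ⟨hr0, hr1, hr2⟩ := hr
  obtain ⟨hq0, hq1, hq2⟩ := hq
  generalize r 0 = a at *
  generalize r 1 = p at *
  generalize r 2 = f at *
  generalize q 0 = b at *
  generalize q 1 = q' at *
  generalize q 2 = g at *
  obtain ⟨e, he⟩ : ∃ e, e = max (a + p + f - a - b) 0 := ⟨_, rfl⟩
  obtain ⟨e₁, he₁⟩ : ∃ e, e = max (g - a) 0 := ⟨_, rfl⟩
  obtain ⟨e₂, he₂⟩ : ∃ e, e = max (f - b) 0 := ⟨_, rfl⟩
  obtain ⟨e₃, he₃⟩ : ∃ e, e = max (f + g - (a + p + f)) 0 := ⟨_, rfl⟩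
  rw [← he, ← he₃]
  refine ⟨!![a + b - (a + p + f) + e, q' - e + e₁, g - e₁;
    p - e + e₂, e - e₁ - e₂ + e₃, e₁ - e₃; f - e₂, e₂ - e₃, e₃], ?_⟩
  simp
  grind

theorem hasPlan_of_adjacent {X : Type*} [PseudoMetricSpace X] {S : Finset X} {x y : X}
    (hxy : dist x y = 1) (hxS : x ∈ S) (hyS : y ∈ S) {f g : X → ℝ} (hf0 : ∀ z, 0 ≤ f z)
    (hg0 : ∀ z, 0 ≤ g z) (hfS : ∀ z, f z ≠ 0 → z ∈ S) (hgS : ∀ z, g z ≠ 0 → z ∈ S)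
    (hf1 : ∑ z ∈ S, f z = 1) (hg1 : ∑ z ∈ S, g z = 1) (hf : ∀ z, f z ≠ 0 → dist z x = 1)
    (hg : ∀ z, g z ≠ 0 → z = y ∨ dist z y = 1) :
    HasPlan S (fun u v => dist u v) f g
      (1 + max (1 - f y - g x -
            ∑ z ∈ S, if dist z x = 1 ∧ dist z y = 1 then max (f z) (g z) else 0) 0
         + max (1 - f y - g x -
            ∑ z ∈ S, if dist z x = 1 ∧ dist z y = 1 then min (f z) (g z) else 0) 0
         - ∑ z ∈ S, if dist z x = 1 ∧ dist z y = 1 then min (f z) (g z) else 0) := by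
  set C : X → Prop := fun z => dist z x = 1 ∧ dist z y = 1 with hC
  have hCx : ¬ C x := by simp [hC]
  have hCy : ¬ C y := by simp [hC]
  set M := ∑ z ∈ S, if C z then max (f z) (g z) else 0 with hM
  set m := ∑ z ∈ S, if C z then min (f z) (g z) else 0 with hm
  set s : Fin 3 → X → ℝ := ![fun u => if u = y then f u else 0,
    fun u => if C u then f u - min (f u) (g u) else 0,
    fun u => if u = y ∨ C u then 0 else f u] with hs
  set t : Fin 3 → X → ℝ := ![fun v => if v = x then g v else 0,
    fun v => if C v then g v - min (f v) (g v) else 0,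
    fun v => if v = x ∨ C v then 0 else g v] with ht
  have hs0 : ∀ i u, 0 ≤ s i u := by
    intro i u
    fin_cases i <;> simp [hs] <;> split_ifs <;> simp [hf0]
  have ht0 : ∀ j v, 0 ≤ t j v := by
    intro j v
    fin_cases j <;> simp [ht] <;> split_ifs <;> simp [hg0]
  have hsf : ∀ i u, s i u ≠ 0 → f u ≠ 0 := by
    intro i u h h0
    apply h
    fin_cases i <;> simp [hs, h0, hg0]
  have htg : ∀ j v, t j v ≠ 0 → g v ≠ 0 := by
    intro j v h h0
    apply h
    fin_cases j <;> simp [ht, h0, hf0]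
  have hsum : ∀ u, f u = (if C u then min (f u) (g u) else 0) + ∑ i, s i u := by
    intro u
    simp only [hs, Fin.sum_univ_three]
    by_cases h : C u
    · have : u ≠ y := by rintro rfl; exact hCy h
      simp [h, this]
    · by_cases h' : u = y <;> simp [h, h']
      simp [hCy]
  have htsum : ∀ v, g v = (if C v then min (f v) (g v) else 0) + ∑ j, t j v := by
    intro v
    simp only [ht, Fin.sum_univ_three]
    by_cases h : C v
    · have : v ≠ x := by rintro rfl; exact hCx h
      simp [h, this]
    · by_cases h' : v = x <;> simp [h, h']
      simp [hCx]
  have hstot : ∑ i, ∑ u ∈ S, s i u = 1 - m := by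
    rw [Finset.sum_comm, ← hf1, Finset.sum_congr rfl fun u _ => hsum u, Finset.sum_add_distrib]
    ring
  have httot : ∑ j, ∑ v ∈ S, t j v = 1 - m := by
    rw [Finset.sum_comm, ← hg1, Finset.sum_congr rfl fun v _ => htsum v, Finset.sum_add_distrib]
    ring
  have hs_zero : ∑ u ∈ S, s 0 u = f y := by simp [hs, hyS]
  have ht_zero : ∑ v ∈ S, t 0 v = g x := by simp [ht, hxS]
  have hs_one : ∑ z ∈ S, s 1 z + ∑ z ∈ S, t 1 z = M - m := by
    rw [hM, hm, ← Finset.sum_add_distrib, ← Finset.sum_sub_distrib]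
    refine Finset.sum_congr rfl fun z _ => ?_
    have := min_add_max (f z) (g z)
    simp only [hs, ht, Matrix.cons_val_one, Matrix.cons_val_zero]
    split_ifs <;> linarith
  obtain ⟨T, hT0, hTr, hTc, hcost⟩ := exists_antimonotone_plan
    (r := fun i => ∑ u ∈ S, s i u) (q := fun j => ∑ v ∈ S, t j v)
    (fun i => Finset.sum_nonneg fun u _ => hs0 i u)
    (fun j => Finset.sum_nonneg fun v _ => ht0 j v) (hstot.trans httot.symm)
  have hdx : ∀ {u}, f u ≠ 0 → dist u x ≤ 1 := fun h => (hf _ h).le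
  have hdy : ∀ {v}, g v ≠ 0 → dist y v ≤ 1 := by
    intro v h
    rcases hg v h with rfl | h
    · simp
    · exact (dist_comm y v).trans_le h.le
  have hk : ∀ i j u v, s i u ≠ 0 → t j v ≠ 0 →
      dist u v ≤ !![(1 : ℝ), 1, 1; 1, 2, 2; 1, 2, 3] i j := by
    intro i j u v hu hv
    have hux := hdx (hsf i u hu)
    have hyv := hdy (htg j v hv)
    have hu0 : i = 0 → dist u v ≤ 1 := by
      rintro rfl
      obtain rfl : u = y := by by_contra h; simp [hs, h] at hu
      exact hyv
    have hv0 : j = 0 → dist u v ≤ 1 := by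
      rintro rfl
      obtain rfl : v = x := by by_contra h; simp [ht, h] at hv
      exact hux
    have hu1 : i = 1 → dist u v ≤ 2 := by
      rintro rfl
      have h : C u := by by_contra h; simp [hs, h] at hu
      linarith [dist_triangle u y v, h.2]
    have hv1 : j = 1 → dist u v ≤ 2 := by
      rintro rfl
      have h : C v := by by_contra h; simp [ht, h] at hv
      linarith [dist_triangle_right u v x, h.1]
    have h3 : dist u v ≤ 3 := by linarith [dist_triangle4 u x y v]
    fin_cases i <;> fin_cases j <;>
      first | exact hu0 rfl | exact hv0 rfl | exact hu1 rfl | exact hv1 rfl | exact h3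
  have hplan := HasPlan.of_classes (d := fun u v => dist u v) hs0 ht0
    (fun i u h => hfS u (hsf i u h)) (fun j v h => hgS v (htg j v h)) hT0 hTr hTc hk
  have hdiag : HasPlan S (fun u v => dist u v) (fun z => if C z then min (f z) (g z) else 0)
      (fun z => if C z then min (f z) (g z) else 0) 0 := by
    refine HasPlan.refl (fun u => dist_self u) (fun u => ?_) fun u h => hfS u fun h0 => h ?_
    · split_ifs
      exacts [le_min (hf0 u) (hg0 u), le_rfl]
    · simp [h0, hg0]
  convert hdiag.add hplan using 1
  · ext u; simpa using hsum u
  · ext v; simpa using htsum v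
  · rw [hcost, hstot, hs_zero, ht_zero]
    rw [Fin.sum_univ_three] at hstot httot
    have e : ∑ u ∈ S, s 2 u + ∑ v ∈ S, t 2 v - (1 - m) = 1 - f y - g x - M := by linarith
    rw [e, show 1 - m - f y - g x = 1 - f y - g x - m by ring]
    ring

/-- Main theorem: upper bound on the Wasserstein distance for local measures with
laziness `α = μx x` removed and renormalized. -/
theorem main_wasserstein_upper_bound {X : Type*} [MetricSpace X]
    (hint : ∀ u v : X, u ≠ v → ∃ n : ℕ, 0 < n ∧ dist u v = n)
    (x y : X) (hxy : dist x y = 1)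
    (μx μy : X → ℝ) (hμx : IsFinProb μx) (hμy : IsFinProb μy)
    (hsx : ∀ z, μx z ≠ 0 → z = x ∨ dist z x = 1)
    (hsy : ∀ z, μy z ≠ 0 → z = y ∨ dist z y = 1)
    (hle : μx x ≤ μy y) (hα : μx x < 1)
    (νx νy : X → ℝ)
    (hνx : νx = fun z => (μx z - (if z = x then μx x else 0)) / (1 - μx x))
    (hνy : νy = fun z => (μy z - (if z = y then μx x else 0)) / (1 - μx x)) :
    W1 (fun u v => dist u v) μx μy ≤
      μx x + (1 - μx x) *
        (1 + max (1 - νx y - νy x -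
              ∑ᶠ z, if dist z x = 1 ∧ dist z y = 1 then max (νx z) (νy z) else 0) 0
           + max (1 - νx y - νy x -
              ∑ᶠ z, if dist z x = 1 ∧ dist z y = 1 then min (νx z) (νy z) else 0) 0
           - ∑ᶠ z, if dist z x = 1 ∧ dist z y = 1 then min (νx z) (νy z) else 0) := by
  obtain ⟨hμx0, hμxfin, hμx1⟩ := hμx
  obtain ⟨hμy0, hμyfin, hμy1⟩ := hμy
  set α := μx x with hαdef
  have hpos : 0 < 1 - α := sub_pos.2 hα
  set S : Finset X := hμxfin.toFinset ∪ hμyfin.toFinset ∪ {x, y} with hS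
  have hxS : x ∈ S := by simp [hS]
  have hyS : y ∈ S := by simp [hS]
  have hμxS : ∀ z, μx z ≠ 0 → z ∈ S := fun z h => by simp [hS, h]
  have hμyS : ∀ z, μy z ≠ 0 → z ∈ S := fun z h => by simp [hS, h]
  have hνx' : ∀ z, (1 - α) * νx z = μx z - if z = x then α else 0 := fun z => by
    rw [hνx]; exact mul_div_cancel₀ _ hpos.ne'
  have hνy' : ∀ z, (1 - α) * νy z = μy z - if z = y then α else 0 := fun z => by
    rw [hνy]; exact mul_div_cancel₀ _ hpos.ne'
  have hνx0 : ∀ z, 0 ≤ νx z := fun z => by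
    rw [hνx]
    refine div_nonneg ?_ hpos.le
    split_ifs with h
    · simp [h, hαdef]
    · simpa using hμx0 z
  have hνy0 : ∀ z, 0 ≤ νy z := fun z => by
    rw [hνy]
    refine div_nonneg ?_ hpos.le
    split_ifs with h
    · simpa [h] using hle
    · simpa using hμy0 z
  have hνxx : νx x = 0 := by simp [hνx, hαdef]
  have hνμx : ∀ z, νx z ≠ 0 → z ≠ x ∧ μx z ≠ 0 := by
    intro z h
    have hzx : z ≠ x := by rintro rfl; exact h hνxx
    exact ⟨hzx, fun h0 => h (by simp [hνx, hzx, h0])⟩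
  have hνμy : ∀ z, νy z ≠ 0 → z = y ∨ μy z ≠ 0 := by
    intro z h
    by_contra! hz
    exact h (by simp [hνy, hz.1, hz.2])
  have hνxS : ∀ z, νx z ≠ 0 → z ∈ S := fun z h => hμxS z (hνμx z h).2
  have hνyS : ∀ z, νy z ≠ 0 → z ∈ S := fun z h => by
    rcases hνμy z h with rfl | h
    exacts [hyS, hμyS z h]
  rw [finsum_eq_sum_of_support_subset (s := S) μx fun z h => hμxS z h] at hμx1
  rw [finsum_eq_sum_of_support_subset (s := S) μy fun z h => hμyS z h] at hμy1
  have hνx1 : ∑ z ∈ S, νx z = 1 := by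
    refine mul_left_cancel₀ hpos.ne' ?_
    rw [Finset.mul_sum, Finset.sum_congr rfl fun z _ => hνx' z]
    simp [Finset.sum_sub_distrib, hxS, hμx1]
  have hνy1 : ∑ z ∈ S, νy z = 1 := by
    refine mul_left_cancel₀ hpos.ne' ?_
    rw [Finset.mul_sum, Finset.sum_congr rfl fun z _ => hνy' z]
    simp [Finset.sum_sub_distrib, hyS, hμy1]
  have hplan := hasPlan_of_adjacent hxy hxS hyS hνx0 hνy0 hνxS hνyS hνx1 hνy1
    (fun z h => (hsx z (hνμx z h).2).resolve_left (hνμx z h).1)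
    (fun z h => (hνμy z h).elim Or.inl (hsy z))
  have htotal := ((HasPlan.single (d := fun u v => dist u v) hxS hyS).smul
    (hμx0 x)).add (hplan.smul hpos.le)
  have hmax : ∑ᶠ z, (if dist z x = 1 ∧ dist z y = 1 then max (νx z) (νy z) else 0) =
      ∑ z ∈ S, if dist z x = 1 ∧ dist z y = 1 then max (νx z) (νy z) else 0 := by
    refine finsum_eq_sum_of_support_subset _ fun z hz => by_contra fun h => hz ?_
    have h1 : νx z = 0 := by_contra fun h1 => h (hνxS z h1)
    have h2 : νy z = 0 := by_contra fun h2 => h (hνyS z h2)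
    simp [h1, h2]
  have hmin : ∑ᶠ z, (if dist z x = 1 ∧ dist z y = 1 then min (νx z) (νy z) else 0) =
      ∑ z ∈ S, if dist z x = 1 ∧ dist z y = 1 then min (νx z) (νy z) else 0 := by
    refine finsum_eq_sum_of_support_subset _ fun z hz => by_contra fun h => hz ?_
    have h1 : νx z = 0 := by_contra fun h1 => h (hνxS z h1)
    have h2 : νy z = 0 := by_contra fun h2 => h (hνyS z h2)
    simp [h1, h2]
  rw [hmax, hmin]
  refine HasPlan.W1_le (S := S) ?_ fun u v => dist_nonneg
  convert htotal using 1
  · ext z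
    simp [hνx' z, Pi.single_apply, ← hαdef]
  · ext z
    simp [hνy' z, Pi.single_apply, ← hαdef]
  · rw [hxy, mul_one]
end

section
/- Let (X, d) be a metric space in which the distance between any two distinct points is a positive integer, and let x, y ∈ X satisfy d(x, y) = 1. Let μ_x and μ_y be finitely supported probability measures on X with μ_x supported on {z : d(z, x) = 1} and μ_y supported on {z : d(z, y) = 1}. Then W₁(μ_x, μ_y) ≤ 1 + 2 (1 − μ_x(y) − μ_y(x))₊. -/
open scoped Classical

lemma W1_le_sum {X : Type*} {d : X → X → ℝ} (hd : ∀ u v, 0 ≤ d u v) {μ ν : X → ℝ}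
    (S : Finset X) (f : X → X → ℝ) (hf : ∀ u v, 0 ≤ f u v)
    (hfS : ∀ u v, f u v ≠ 0 → u ∈ S ∧ v ∈ S)
    (hμ : ∀ u, ∑ v ∈ S, f u v = μ u) (hν : ∀ v, ∑ u ∈ S, f u v = ν v) :
    W1 d μ ν ≤ ∑ u ∈ S, ∑ v ∈ S, d u v * f u v := by
  refine csInf_le ⟨0, ?_⟩ ⟨Finsupp.onFinset (S ×ˢ S) (fun p => f p.1 p.2)
    fun p hp => Finset.mem_product.2 (hfS _ _ hp), fun p => hf _ _, fun u => ?_, fun v => ?_, ?_⟩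
  · rintro c ⟨γ, hγ, -, -, rfl⟩
    exact finsum_nonneg fun p => mul_nonneg (hd _ _) (hγ p)
  · rw [← hμ u]
    exact finsum_eq_sum_of_support_subset _ fun v hv => (hfS u v hv).2
  · rw [← hν v]
    exact finsum_eq_sum_of_support_subset _ fun u hu => (hfS u v hu).1
  · rw [← Finset.sum_product' S S (fun u v => d u v * f u v)]
    refine (finsum_eq_sum_of_support_subset _ fun p hp => ?_).symm
    exact Finset.mem_coe.2 (Finset.mem_product.2 (hfS _ _ (right_ne_zero_of_mul hp)))

lemma IsFinProb.sum_eq_one {X : Type*} {μ : X → ℝ} (hμ : IsFinProb μ) {S : Finset X}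
    (hS : ∀ z, μ z ≠ 0 → z ∈ S) : ∑ z ∈ S, μ z = 1 := by
  rw [← hμ.2.2]
  exact (finsum_eq_sum_of_support_subset _ fun z hz => hS z hz).symm

/-- A product of masses `α` and `β` can be rescaled to have total mass `(α + β - 1)₊`, with
marginals not exceeding the original ones. -/
lemma exists_product_scaling {α β : ℝ} (hα : 0 ≤ α) (hβ : 0 ≤ β) (hα1 : α ≤ 1) (hβ1 : β ≤ 1) :
    ∃ r : ℝ, 0 ≤ r ∧ r * α ≤ 1 ∧ r * β ≤ 1 ∧ r * α * β = max (α + β - 1) 0 := by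
  rcases hα.eq_or_lt with rfl | hα
  · exact ⟨0, by simp, by simp, by simp, by simp [hβ1]⟩
  rcases hβ.eq_or_lt with rfl | hβ
  · exact ⟨0, by simp, by simp, by simp, by simp [hα1]⟩
  have h : max (α + β - 1) 0 / (α * β) * α = max (α + β - 1) 0 / β := by field_simp
  have h' : max (α + β - 1) 0 / (α * β) * β = max (α + β - 1) 0 / α := by field_simp
  refine ⟨max (α + β - 1) 0 / (α * β), by positivity, ?_, ?_, by field_simp⟩
  · rw [h, div_le_one hβ]
    exact max_le (by linarith) hβ.le
  · rw [h', div_le_one hα]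
    exact max_le (by linarith) hα.le

/-- Simple upper bound: `W₁(μx, μy) ≤ 1 + 2 (1 - μx(y) - μy(x))₊`. -/
theorem wasserstein_simple_upper_bound {X : Type*} [MetricSpace X]
    (hint : ∀ u v : X, u ≠ v → ∃ n : ℕ, 0 < n ∧ dist u v = n)
    (x y : X) (hxy : dist x y = 1)
    (μx μy : X → ℝ) (hμx : IsFinProb μx) (hμy : IsFinProb μy)
    (hsx : ∀ z, μx z ≠ 0 → dist z x = 1)
    (hsy : ∀ z, μy z ≠ 0 → dist z y = 1) :
    W1 (fun u v => dist u v) μx μy ≤ 1 + 2 * max (1 - μx y - μy x) 0 := by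
  set S : Finset X := insert x (insert y (hμx.2.1.toFinset ∪ hμy.2.1.toFinset)) with hS
  have hxS : x ∈ S := by simp [hS]
  have hyS : y ∈ S := by simp [hS]
  have hμxS : ∀ z, μx z ≠ 0 → z ∈ S := fun z hz => by simp [hS, hz]
  have hμyS : ∀ z, μy z ≠ 0 → z ∈ S := fun z hz => by simp [hS, hz]
  have hsumx := hμx.sum_eq_one hμxS
  have hsumy := hμy.sum_eq_one hμyS
  have ha1 : μx y ≤ 1 := hsumx ▸ Finset.single_le_sum (fun z _ => hμx.1 z) hyS
  have hb1 : μy x ≤ 1 := hsumy ▸ Finset.single_le_sum (fun z _ => hμy.1 z) hxS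
  have ha0 := hμx.1 y
  have hb0 := hμy.1 x
  obtain ⟨r, hr0, hrα, hrβ, hr⟩ := exists_product_scaling (α := 1 - μx y) (β := 1 - μy x)
    (by linarith) (by linarith) (by linarith) (by linarith)
  rw [show 1 - μx y + (1 - μy x) - 1 = 1 - μx y - μy x by ring] at hr
  set t := max (1 - μx y - μy x) 0
  have ht1 : 1 - μx y - μy x ≤ t := le_max_left _ _
  let μ' : X → ℝ := fun u => if u = y then 0 else μx u
  let ν' : X → ℝ := fun v => if v = x then 0 else μy v
  let δx : X → ℝ := fun v => if v = x then 1 else 0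
  let δy : X → ℝ := fun u => if u = y then 1 else 0
  have hμ'0 : ∀ u, 0 ≤ μ' u := fun u => by
    dsimp only [μ']; split_ifs; exacts [le_rfl, hμx.1 u]
  have hν'0 : ∀ v, 0 ≤ ν' v := fun v => by
    dsimp only [ν']; split_ifs; exacts [le_rfl, hμy.1 v]
  have hδx0 : ∀ v, 0 ≤ δx v := fun v => by dsimp only [δx]; split_ifs <;> simp
  have hδy0 : ∀ u, 0 ≤ δy u := fun u => by dsimp only [δy]; split_ifs <;> simp
  have hμ'eq : ∀ u, μx u = μ' u + μx y * δy u := fun u => by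
    by_cases h : u = y <;> simp [μ', δy, h]
  have hν'eq : ∀ v, μy v = ν' v + μy x * δx v := fun v => by
    by_cases h : v = x <;> simp [ν', δx, h]
  have hδxsum : ∑ v ∈ S, δx v = 1 := by simp [δx, hxS]
  have hδysum : ∑ u ∈ S, δy u = 1 := by simp [δy, hyS]
  have hμ'sum : ∑ u ∈ S, μ' u = 1 - μx y := by
    have h := Finset.sum_congr rfl fun u (_ : u ∈ S) => hμ'eq u
    rw [Finset.sum_add_distrib, ← Finset.mul_sum, hδysum, hsumx] at h
    linarith
  have hν'sum : ∑ v ∈ S, ν' v = 1 - μy x := by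
    have h := Finset.sum_congr rfl fun v (_ : v ∈ S) => hν'eq v
    rw [Finset.sum_add_distrib, ← Finset.mul_sum, hδxsum, hsumy] at h
    linarith
  let f : X → X → ℝ := fun u v => (t - (1 - μx y - μy x)) * δy u * δx v +
    (1 - r * (1 - μy x)) * μ' u * δx v + (1 - r * (1 - μx y)) * δy u * ν' v + r * μ' u * ν' v
  have hf0 : ∀ u v, 0 ≤ f u v := fun u v => by
    have h1 := sub_nonneg.2 ht1
    have h2 := sub_nonneg.2 hrα
    have h3 := sub_nonneg.2 hrβ
    have h4 := hμ'0 u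
    have h5 := hν'0 v
    have h6 := hδx0 v
    have h7 := hδy0 u
    dsimp only [f]
    positivity
  have hrow : ∀ u, ∑ v ∈ S, f u v = μx u := fun u => by
    simp only [f, Finset.sum_add_distrib, ← Finset.mul_sum, hδxsum, hν'sum]
    rw [hμ'eq u]
    linear_combination (-δy u) * hr
  have hcol : ∀ v, ∑ u ∈ S, f u v = μy v := fun v => by
    simp only [f, Finset.sum_add_distrib, ← Finset.mul_sum, ← Finset.sum_mul, hδysum, hμ'sum]
    rw [hν'eq v]
    linear_combination (-δx v) * hr
  have hfS : ∀ u v, f u v ≠ 0 → u ∈ S ∧ v ∈ S := fun u v h => by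
    constructor
    · by_contra hu
      have h1 : u ≠ y := fun e => hu (e ▸ hyS)
      have h2 : μx u = 0 := by_contra fun e => hu (hμxS u e)
      exact h (by simp [f, μ', δy, h1, h2])
    · by_contra hv
      have h1 : v ≠ x := fun e => hv (e ▸ hxS)
      have h2 : μy v = 0 := by_contra fun e => hv (hμyS v e)
      exact h (by simp [f, ν', δx, h1, h2])
  have hcost : ∀ u v, dist u v * f u v ≤ f u v + 2 * (r * μ' u * ν' v) := fun u v => by
    have hprod : 0 ≤ r * μ' u * ν' v := mul_nonneg (mul_nonneg hr0 (hμ'0 u)) (hν'0 v)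
    by_cases hu : u = y
    · by_cases hv : v = x
      · simp [hu, hv, dist_comm y x, hxy, μ']
      · by_cases hv0 : μy v = 0
        · simp [f, μ', ν', δx, hu, hv, hv0]
        · have : dist u v = 1 := by rw [hu, dist_comm]; exact hsy v hv0
          rw [this]; linarith
    · by_cases hu0 : μx u = 0
      · simp [f, μ', δy, hu, hu0]
      · have hux := hsx u hu0
        by_cases hv : v = x
        · rw [hv] at hprod ⊢
          rw [hux]; linarith
        · by_cases hv0 : μy v = 0
          · simp [f, ν', δx, hv, hv0]
          · have hd : dist u v ≤ 3 := by
              have h1 := dist_triangle4 u x y v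
              have h2 := hsy v hv0
              rw [dist_comm] at h2
              linarith
            have hfuv : f u v = r * μ' u * ν' v := by simp [f, δx, δy, hu, hv]
            rw [hfuv]
            nlinarith
  calc W1 (fun u v => dist u v) μx μy ≤ ∑ u ∈ S, ∑ v ∈ S, dist u v * f u v :=
        W1_le_sum (fun _ _ => dist_nonneg) S f hf0 hfS hrow hcol
    _ ≤ ∑ u ∈ S, ∑ v ∈ S, (f u v + 2 * (r * μ' u * ν' v)) :=
        Finset.sum_le_sum fun u _ => Finset.sum_le_sum fun v _ => hcost u v
    _ = 1 + 2 * t := by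
        simp only [Finset.sum_add_distrib, hrow, hsumx, ← Finset.mul_sum, ← Finset.sum_mul,
          hμ'sum, hν'sum, hr]
end

section
/- Let (X, d) be a metric space in which the distance between any two distinct points is a positive integer, and let x, y ∈ X satisfy d(x, y) = 1. Let μ_x and μ_y be finitely supported probability measures on X with μ_x supported on {z : d(z, x) = 1} and μ_y supported on {z : d(z, y) = 1}. Then the Ollivier–Ricci curvature satisfies κ(x, y) ≥ −2 (1 − μ_x(y) − μ_y(x))₊. -/
open scoped Classical

/-- The total transport cost of any finitely supported coupling bounds `W1` from above. -/
theorem W1_le_of_coupling {X : Type*} {d : X → X → ℝ} (hd : ∀ u v, 0 ≤ d u v) {μ ν : X → ℝ}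
    (S : Finset X) (F : X → X → ℝ) (hF : ∀ u v, 0 ≤ F u v)
    (hS : ∀ u v, F u v ≠ 0 → u ∈ S ∧ v ∈ S)
    (hμ : ∀ u, ∑ v ∈ S, F u v = μ u) (hν : ∀ v, ∑ u ∈ S, F u v = ν v) :
    W1 d μ ν ≤ ∑ u ∈ S, ∑ v ∈ S, d u v * F u v := by
  refine csInf_le ⟨0, ?_⟩ ⟨Finsupp.onFinset (S ×ˢ S) (fun p => F p.1 p.2)
    fun p hp => Finset.mem_product.2 (hS _ _ hp), fun p => hF _ _, fun u => ?_, fun v => ?_, ?_⟩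
  · rintro c ⟨γ, hγ, -, -, rfl⟩
    exact finsum_nonneg fun p => mul_nonneg (hd _ _) (hγ p)
  · rw [← hμ u]
    exact finsum_eq_sum_of_support_subset _ fun v hv => (hS u v hv).2
  · rw [← hν v]
    exact finsum_eq_sum_of_support_subset _ fun u hu => (hS u v hu).1
  · rw [← Finset.sum_product' S S fun u v => d u v * F u v]
    refine (finsum_eq_sum_of_support_subset _ fun p hp => ?_).symm
    exact Finset.mem_coe.2 (Finset.mem_product.2 (hS _ _ (right_ne_zero_of_mul hp)))

/-- Conditioning a mass function on the complement of a point. -/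
theorem exists_mass_off_point {X : Type*} {μ : X → ℝ} (hμ : IsFinProb μ) (y : X) (S : Finset X)
    (hS : ∀ z, μ z ≠ 0 → z ∈ S) (hy : y ∈ S) :
    μ y ≤ 1 ∧ ∃ f : X → ℝ, (∀ u, 0 ≤ f u) ∧ (∀ u, f u ≠ 0 → μ u ≠ 0) ∧
      (∀ u, μ u = (1 - μ y) * f u + if u = y then μ y else 0) ∧
      (μ y = 1 ∨ ∑ u ∈ S, f u = 1) := by
  obtain ⟨h0, -, h1⟩ := hμ
  rw [finsum_eq_sum_of_support_subset _ (fun z hz => hS z hz)] at h1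
  have hsplit := Finset.add_sum_erase S μ hy
  rw [h1] at hsplit
  have hoff : 0 ≤ ∑ u ∈ S.erase y, μ u := Finset.sum_nonneg fun u _ => h0 u
  refine ⟨by linarith, fun u => if u = y then 0 else μ u / (1 - μ y), fun u => ?_,
    fun u hu h => hu (by simp [h]), fun u => ?_, or_iff_not_imp_left.2 fun hne => ?_⟩
  · dsimp only
    split_ifs
    exacts [le_rfl, div_nonneg (h0 u) (by linarith)]
  · by_cases huy : u = y
    · simp [huy]
    · by_cases hne : 1 - μ y = 0
      · have hz : ∑ u ∈ S.erase y, μ u = 0 := by linarith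
        have : μ u = 0 := by
          by_contra hu
          exact hu ((Finset.sum_eq_zero_iff_of_nonneg fun u _ => h0 u).1 hz u
            (Finset.mem_erase.2 ⟨huy, hS u hu⟩))
        simp [huy, this]
      · simp [huy, mul_div_cancel₀ _ hne]
  · have hne' : 1 - μ y ≠ 0 := fun h => hne (by linarith)
    rw [← Finset.add_sum_erase S _ hy, if_pos rfl, zero_add,
      Finset.sum_congr rfl fun u hu => if_neg (Finset.ne_of_mem_erase hu), ← Finset.sum_div,
      div_eq_one_iff_eq hne']
    linarith

/-- Simple lower bound on the Ollivier–Ricci curvature: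
`κ(x, y) ≥ -2 (1 - μx(y) - μy(x))₊`. -/
theorem orc_simple_lower_bound {X : Type*} [MetricSpace X]
    (hint : ∀ u v : X, u ≠ v → ∃ n : ℕ, 0 < n ∧ dist u v = n)
    (x y : X) (hxy : dist x y = 1)
    (μx μy : X → ℝ) (hμx : IsFinProb μx) (hμy : IsFinProb μy)
    (hsx : ∀ z, μx z ≠ 0 → dist z x = 1)
    (hsy : ∀ z, μy z ≠ 0 → dist z y = 1) :
    1 - W1 (fun u v => dist u v) μx μy ≥ -(2 * max (1 - μx y - μy x) 0) := by
  set S : Finset X := insert x (insert y (hμx.2.1.toFinset ∪ hμy.2.1.toFinset)) with hSdef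
  have hxS : x ∈ S := by simp [hSdef]
  have hyS : y ∈ S := by simp [hSdef]
  have hSx : ∀ z, μx z ≠ 0 → z ∈ S := fun z hz => by simp [hSdef, hz]
  have hSy : ∀ z, μy z ≠ 0 → z ∈ S := fun z hz => by simp [hSdef, hz]
  obtain ⟨ha, f, hf0, hfs, hfμ, hf1⟩ := exists_mass_off_point hμx y S hSx hyS
  obtain ⟨hb, g, hg0, hgs, hgμ, hg1⟩ := exists_mass_off_point hμy x S hSy hxS
  have ha0 := hμx.1 y
  have hb0 := hμy.1 x
  set a := μx y
  set b := μy x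
  set m := max (1 - a - b) 0 with hm
  have hm0 : 0 ≤ m := le_max_right _ _
  have hma : m ≤ 1 - a := max_le (by linarith) (by linarith)
  have hmb : m ≤ 1 - b := max_le (by linarith) (by linarith)
  have hk : 0 ≤ a + b - 1 + m := by linarith [le_max_left (1 - a - b) 0]
  have hmf : m * ∑ u ∈ S, f u = m ∧ (1 - a - m) * ∑ u ∈ S, f u = 1 - a - m := by
    rcases hf1 with h | h
    · have : m = 0 := by linarith
      simp [this, h]
    · simp [h]
  have hmg : m * ∑ v ∈ S, g v = m ∧ (1 - b - m) * ∑ v ∈ S, g v = 1 - b - m := by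
    rcases hg1 with h | h
    · have : m = 0 := by linarith
      simp [this, h]
    · simp [h]
  let δ : X → X → ℝ := fun p u => if u = p then 1 else 0
  have hδ0 : ∀ p u, 0 ≤ δ p u := fun p u => by
    simp only [δ]
    split_ifs <;> norm_num
  have hδy : ∑ u ∈ S, δ y u = 1 := by simp [δ, hyS]
  have hδx : ∑ v ∈ S, δ x v = 1 := by simp [δ, hxS]
  have hfμ' : ∀ u, μx u = (1 - a) * f u + a * δ y u := fun u => by simpa [δ] using hfμ u
  have hgμ' : ∀ v, μy v = (1 - b) * g v + b * δ x v := fun v => by simpa [δ] using hgμ v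
  let F : X → X → ℝ := fun u v => m * f u * g v + (1 - b - m) * δ y u * g v +
    (1 - a - m) * f u * δ x v + (a + b - 1 + m) * δ y u * δ x v
  have hF0 : ∀ u v, 0 ≤ F u v := fun u v => by
    have h1 := mul_nonneg (mul_nonneg hm0 (hf0 u)) (hg0 v)
    have h2 := mul_nonneg (mul_nonneg (sub_nonneg.2 hmb) (hδ0 y u)) (hg0 v)
    have h3 := mul_nonneg (mul_nonneg (sub_nonneg.2 hma) (hf0 u)) (hδ0 x v)
    have h4 := mul_nonneg (mul_nonneg hk (hδ0 y u)) (hδ0 x v)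
    simp only [F]
    linarith
  have hFS : ∀ u v, F u v ≠ 0 → u ∈ S ∧ v ∈ S := by
    intro u v h
    constructor
    · by_contra hu
      have h1 : f u = 0 := by_contra fun h => hu (hSx u (hfs u h))
      have h2 : δ y u = 0 := if_neg fun h : u = y => hu (h ▸ hyS)
      simp [F, h1, h2] at h
    · by_contra hv
      have h1 : g v = 0 := by_contra fun h => hv (hSy v (hgs v h))
      have h2 : δ x v = 0 := if_neg fun h : v = x => hv (h ▸ hxS)
      simp [F, h1, h2] at h
  have hrow : ∀ u, ∑ v ∈ S, F u v = μx u := fun u => by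
    simp only [F, Finset.sum_add_distrib, ← Finset.mul_sum, hδx, hfμ' u]
    linear_combination f u * hmg.1 + δ y u * hmg.2
  have hcol : ∀ v, ∑ u ∈ S, F u v = μy v := fun v => by
    simp only [F, Finset.sum_add_distrib, ← Finset.mul_sum, ← Finset.sum_mul, hδy, hgμ' v]
    linear_combination g v * hmf.1 + δ x v * hmf.2
  have hyx : dist y x = 1 := by rw [dist_comm, hxy]
  have hpt : ∀ u v, dist u v * F u v ≤ F u v + 2 * (m * f u * g v) := by
    intro u v
    have hfd : f u ≠ 0 → dist u x = 1 := fun h => hsx u (hfs u h)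
    have hgd : g v ≠ 0 → dist v y = 1 := fun h => hsy v (hgs v h)
    have h1 : dist u v * (m * f u * g v) ≤ 3 * (m * f u * g v) := by
      by_cases hf : f u = 0
      · simp [hf]
      by_cases hg : g v = 0
      · simp [hg]
      refine mul_le_mul_of_nonneg_right ?_ (mul_nonneg (mul_nonneg hm0 (hf0 u)) (hg0 v))
      have := dist_triangle4 u x y v
      rw [hfd hf, hxy, dist_comm y v, hgd hg] at this
      linarith
    have h2 : dist u v * (δ y u * g v) = δ y u * g v := by
      by_cases hu : u = y
      · by_cases hg : g v = 0
        · simp [hg]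
        · rw [hu, dist_comm, hgd hg, one_mul]
      · simp [δ, hu]
    have h3 : dist u v * (f u * δ x v) = f u * δ x v := by
      by_cases hv : v = x
      · by_cases hf : f u = 0
        · simp [hf]
        · rw [hv, hfd hf, one_mul]
      · simp [δ, hv]
    have h4 : dist u v * (δ y u * δ x v) = δ y u * δ x v := by
      by_cases hu : u = y
      · by_cases hv : v = x
        · rw [hu, hv, hyx, one_mul]
        · simp [δ, hv]
      · simp [δ, hu]
    simp only [F]
    linear_combination h1 + (1 - b - m) * h2 + (1 - a - m) * h3 + (a + b - 1 + m) * h4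
  have hmass : ∑ u ∈ S, μx u = 1 := by
    rw [← hμx.2.2]
    exact (finsum_eq_sum_of_support_subset _ fun z hz => hSx z hz).symm
  have hcost : ∑ u ∈ S, ∑ v ∈ S, dist u v * F u v ≤ 1 + 2 * m := by
    calc ∑ u ∈ S, ∑ v ∈ S, dist u v * F u v
        ≤ ∑ u ∈ S, ∑ v ∈ S, (F u v + 2 * (m * f u * g v)) :=
          Finset.sum_le_sum fun u _ => Finset.sum_le_sum fun v _ => hpt u v
      _ = 1 + 2 * (m * (∑ u ∈ S, f u) * ∑ v ∈ S, g v) := by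
          simp only [Finset.sum_add_distrib, hrow, hmass, ← Finset.mul_sum, ← Finset.sum_mul]
      _ = 1 + 2 * m := by rw [hmf.1, hmg.1]
  have := W1_le_of_coupling (d := fun u v => dist u v) (fun u v => dist_nonneg) S F hF0 hFS hrow hcol
  linarith
end
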